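/- arXiv:1605.03631 — 3 statements merged into one kernel-verified Lean document; each statement's English description precedes it below -/
import Mathlib

section
/- Let q be any probability density with respect to μ such that ∫ T q dμ = λ, and suppose the exponentially tilted density p̂_θ also satisfies ∫ T p̂_θ dμ = λ. Then KL(q‖p₀) ≥ KL(p̂_θ‖p₀); i.e., among all probability densities matching the moment constraint E[T] = λ, the exponentially tilted density p̂_θ = exp(θT − ln M(θ)) p₀ minimizes the Kullback–Leibler divergence to the reference density p₀. -/
open MeasureTheory Real

/-- Pointwise Gibbs inequality relative to the tilted value `exp c * b`. -/
lemma mul_add_sub_exp_mul_le_mul_log_div {a b : ℝ} (ha : 0 ≤ a) (hb : 0 ≤ b)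
    (hab : b = 0 → a = 0) (c : ℝ) :
    c * a + a - exp c * b ≤ a * log (a / b) := by
  rcases ha.eq_or_lt with rfl | ha'
  · simpa using mul_nonneg (exp_pos c).le hb
  · have hb' : 0 < b := hb.lt_of_ne fun h => ha'.ne' (hab h.symm)
    have h := log_le_sub_one_of_pos (show 0 < exp c * b / a by positivity)
    rw [log_div (by positivity) ha'.ne', log_mul (exp_ne_zero c) hb'.ne', log_exp] at h
    have hmul := mul_le_mul_of_nonneg_left h ha
    have hcancel : a * (exp c * b / a - 1) = exp c * b - a := by field_simp
    rw [hcancel] at hmul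
    rw [log_div ha'.ne' hb'.ne']
    linarith

/-- The logarithmic density ratio of an exponential tilting is the exponent. -/
lemma exp_mul_mul_log_exp_mul_div (b c : ℝ) :
    exp c * b * log (exp c * b / b) = c * (exp c * b) := by
  rcases eq_or_ne b 0 with rfl | hb
  · simp
  · rw [mul_div_cancel_right₀ _ hb, log_exp, mul_comm]

/-- The integral of an affine function of a statistic `T` against a density `f`. -/
lemma integral_affine_mul_density {Ω : Type*} [MeasurableSpace Ω] {μ : Measure Ω}
    {f T : Ω → ℝ} (hf : ∫ x, f x ∂μ = 1) (hT : Integrable (fun x => T x * f x) μ) (θ k : ℝ) :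
    Integrable (fun x => (θ * T x - k) * f x) μ ∧
      ∫ x, (θ * T x - k) * f x ∂μ = θ * ∫ x, T x * f x ∂μ - k := by
  have hf' := integrable_of_integral_eq_one hf
  have heq : (fun x => (θ * T x - k) * f x) = fun x => θ * (T x * f x) - k * f x := by
    funext x; ring
  rw [heq]
  refine ⟨(hT.const_mul θ).sub (hf'.const_mul k), ?_⟩
  rw [integral_sub (hT.const_mul θ) (hf'.const_mul k), integral_const_mul, integral_const_mul,
    hf, mul_one]

/-- Among all probability densities `q` (w.r.t. `μ`) matching the moment
constraint `∫ T q dμ = λ`, the exponentially tilted density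
`phat_θ = exp (θ T - ln M θ) * p₀` minimizes the KL divergence to the reference density `p₀`:
`KL(q‖p₀) ≥ KL(phat_θ‖p₀)`.  Here `KL(q‖p) = ∫ q ln (q/p) dμ`; finiteness of the KL
divergences is encoded by integrability of the integrands together with absolute
continuity (`p₀ x = 0 → q x = 0` a.e.), and the moment constraints are genuine
(the integrands `T·q`, `T·phat` are integrable). -/
theorem eef_tilted_density_minimizes_kl
    {Ω : Type*} [MeasurableSpace Ω] (μ : Measure Ω) [SigmaFinite μ]
    (p₀ q T phat : Ω → ℝ) (θ lam M : ℝ)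
    (hp₀m : Measurable p₀) (hp₀0 : ∀ x, 0 ≤ p₀ x) (hp₀1 : ∫ x, p₀ x ∂μ = 1)
    (hqm : Measurable q) (hq0 : ∀ x, 0 ≤ q x) (hq1 : ∫ x, q x ∂μ = 1)
    (hTm : Measurable T)
    (hMint : Integrable (fun x => exp (θ * T x) * p₀ x) μ)
    (hMdef : M = ∫ x, exp (θ * T x) * p₀ x ∂μ) (hMpos : 0 < M)
    (hphatdef : phat = fun x => exp (θ * T x - log M) * p₀ x)
    (hqTint : Integrable (fun x => T x * q x) μ)
    (hphatTint : Integrable (fun x => T x * phat x) μ)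
    (hqmom : ∫ x, T x * q x ∂μ = lam)
    (hphatmom : ∫ x, T x * phat x ∂μ = lam)
    (hac : ∀ᵐ x ∂μ, p₀ x = 0 → q x = 0)
    (hKLq : Integrable (fun x => q x * log (q x / p₀ x)) μ)
    (hKLphat : Integrable (fun x => phat x * log (phat x / p₀ x)) μ) :
    ∫ x, phat x * log (phat x / p₀ x) ∂μ ≤ ∫ x, q x * log (q x / p₀ x) ∂μ := by
  have hphat1 : ∫ x, phat x ∂μ = 1 := by
    simp only [hphatdef, exp_sub, exp_log hMpos, div_mul_eq_mul_div]
    rw [integral_div, ← hMdef, div_self hMpos.ne']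
  have hqi := integrable_of_integral_eq_one hq1
  have hphati := integrable_of_integral_eq_one hphat1
  obtain ⟨hqaff, hqval⟩ := integral_affine_mul_density hq1 hqTint θ (log M)
  have hsum : Integrable (fun x => (θ * T x - log M) * q x + q x) μ := hqaff.add hqi
  have hphatval := (integral_affine_mul_density hphat1 hphatTint θ (log M)).2
  calc ∫ x, phat x * log (phat x / p₀ x) ∂μ
      = ∫ x, (θ * T x - log M) * phat x ∂μ := by
        simp only [hphatdef, exp_mul_mul_log_exp_mul_div]
    _ = ∫ x, (θ * T x - log M) * q x + q x - phat x ∂μ := by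
        rw [integral_sub hsum hphati, integral_add hqaff hqi, hqval, hphatval,
          hqmom, hphatmom, hq1, hphat1]
        ring
    _ ≤ ∫ x, q x * log (q x / p₀ x) ∂μ := by
        refine integral_mono_ae (hsum.sub hphati) hKLq ?_
        filter_upwards [hac] with x hx
        simpa only [hphatdef] using
          mul_add_sub_exp_mul_le_mul_log_div (hq0 x) (hp₀0 x) hx (θ * T x - log M)
end

section
/- Let q be any probability density with respect to μ such that ∫ T q dμ = λ, and suppose the exponentially tilted density p̂_θ also satisfies ∫ T p̂_θ dμ = λ. Then the Pythagorean identity KL(q‖p₀) = KL(q‖p̂_θ) + KL(p̂_θ‖p₀) holds. -/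
open MeasureTheory Real

/-- If `r` vanishes where `p` does, tilting `p` by `exp a` shifts `r * log (r / p)` by `r * a`. -/
lemma mul_log_div_eq_mul_log_div_exp_mul_add {r p : ℝ} (a : ℝ) (h : p = 0 → r = 0) :
    r * log (r / p) = r * log (r / (exp a * p)) + r * a := by
  by_cases hr : r = 0
  · simp [hr]
  have hp : p ≠ 0 := mt h hr
  rw [log_div hr hp, log_div hr (mul_ne_zero (exp_ne_zero a) hp),
    log_mul (exp_ne_zero a) hp, log_exp]
  ring

/-- A density `r` with total mass one has `r`-mean of `θ T - c` equal to `θ` times its `T`-moment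
minus `c`. -/
lemma integral_mul_affine_of_integral_eq_one {Ω : Type*} [MeasurableSpace Ω] {μ : Measure Ω}
    {r T : Ω → ℝ} (θ c : ℝ) (hr : ∫ x, r x ∂μ = 1) (hT : Integrable (fun x => T x * r x) μ) :
    Integrable (fun x => r x * (θ * T x - c)) μ ∧
      ∫ x, r x * (θ * T x - c) ∂μ = θ * ∫ x, T x * r x ∂μ - c := by
  have hri : Integrable r μ := .of_integral_ne_zero (by simp [hr])
  have heq : (fun x => r x * (θ * T x - c)) = fun x => θ * (T x * r x) - c * r x := by
    ext x
    ring
  rw [heq]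
  refine ⟨(hT.const_mul θ).sub (hri.const_mul c), ?_⟩
  rw [integral_sub (hT.const_mul θ) (hri.const_mul c), integral_const_mul, integral_const_mul,
    hr, mul_one]

/-- Pythagorean identity for the exponentially tilted density: if `q` is a
probability density with `∫ T q dμ = λ` and the tilted density
`phat_θ = exp (θ T - ln M θ) * p₀` also satisfies `∫ T phat_θ dμ = λ`, then
`KL(q‖p₀) = KL(q‖phat_θ) + KL(phat_θ‖p₀)`.  Here `KL(q‖p) = ∫ q ln (q/p) dμ`; all KL
divergences are assumed finite (integrability of the integrands together with the
absolute continuity `p₀ x = 0 → q x = 0` a.e.) and `T` is `q`- and `phat`-integrable. -/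
theorem eef_kl_pythagorean_identity
    {Ω : Type*} [MeasurableSpace Ω] (μ : Measure Ω) [SigmaFinite μ]
    (p₀ q T phat : Ω → ℝ) (θ lam M : ℝ)
    (hp₀m : Measurable p₀) (hp₀0 : ∀ x, 0 ≤ p₀ x) (hp₀1 : ∫ x, p₀ x ∂μ = 1)
    (hqm : Measurable q) (hq0 : ∀ x, 0 ≤ q x) (hq1 : ∫ x, q x ∂μ = 1)
    (hTm : Measurable T)
    (hMint : Integrable (fun x => exp (θ * T x) * p₀ x) μ)
    (hMdef : M = ∫ x, exp (θ * T x) * p₀ x ∂μ) (hMpos : 0 < M)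
    (hphatdef : phat = fun x => exp (θ * T x - log M) * p₀ x)
    (hqTint : Integrable (fun x => T x * q x) μ)
    (hphatTint : Integrable (fun x => T x * phat x) μ)
    (hqmom : ∫ x, T x * q x ∂μ = lam)
    (hphatmom : ∫ x, T x * phat x ∂μ = lam)
    (hac : ∀ᵐ x ∂μ, p₀ x = 0 → q x = 0)
    (hKLqp₀ : Integrable (fun x => q x * log (q x / p₀ x)) μ)
    (hKLqphat : Integrable (fun x => q x * log (q x / phat x)) μ)
    (hKLphatp₀ : Integrable (fun x => phat x * log (phat x / p₀ x)) μ) :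
    ∫ x, q x * log (q x / p₀ x) ∂μ =
      (∫ x, q x * log (q x / phat x) ∂μ) + ∫ x, phat x * log (phat x / p₀ x) ∂μ := by
  have hphat1 : ∫ x, phat x ∂μ = 1 := by
    have heq : phat = fun x => M⁻¹ * (exp (θ * T x) * p₀ x) := by
      ext x
      simp only [hphatdef, exp_sub, exp_log hMpos]
      ring
    rw [heq, integral_const_mul, ← hMdef, inv_mul_cancel₀ hMpos.ne']
  obtain ⟨hqi, hqe⟩ := integral_mul_affine_of_integral_eq_one θ (log M) hq1 hqTint
  have hphate := (integral_mul_affine_of_integral_eq_one θ (log M) hphat1 hphatTint).2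
  have hq : ∫ x, q x * log (q x / p₀ x) ∂μ =
      ∫ x, (q x * log (q x / phat x) + q x * (θ * T x - log M)) ∂μ := by
    refine integral_congr_ae ?_
    filter_upwards [hac] with x hx
    rw [hphatdef]
    exact mul_log_div_eq_mul_log_div_exp_mul_add _ hx
  have hphat : ∫ x, phat x * log (phat x / p₀ x) ∂μ = ∫ x, phat x * (θ * T x - log M) ∂μ := by
    congr 1 with x
    have hx : phat x = exp (θ * T x - log M) * p₀ x := by rw [hphatdef]
    rw [mul_log_div_eq_mul_log_div_exp_mul_add (θ * T x - log M)
      (fun h => by rw [hx, h, mul_zero]), ← hx]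
    by_cases h0 : phat x = 0 <;> simp [h0]
  rw [hq, integral_add hKLqphat hqi, hqe, hphat, hphate, hqmom, hphatmom]
end

section
/- The PDF constructed by the PDF Projection Theorem is a valid probability density that exactly reproduces the given feature PDF: the measure Q on Ω defined by dQ/dP₀(x) = p_i(f(x)) / p₀z(f(x)) is a probability measure, and the pushforward of Q under the feature map f equals the measure ν.withDensity p_i on the feature space, i.e., the density of f under Q is exactly p_i. -/
open MeasureTheory Real

theorem MeasureTheory.Measure.map_withDensity_comp {Ω Z : Type*} [MeasurableSpace Ω]
    [MeasurableSpace Z] (μ : Measure Ω) {f : Ω → Z} (hf : Measurable f)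
    {g : Z → ENNReal} (hg : Measurable g) :
    (μ.withDensity (fun x => g (f x))).map f = (μ.map f).withDensity g := by
  ext s hs
  rw [Measure.map_apply hf hs, withDensity_apply _ (hf hs), withDensity_apply _ hs,
    setLIntegral_map hs hg hf]

/-- PDF Projection Theorem: Let `P₀` be a reference probability measure on
the raw-data space `Ω`, `f : Ω → Z` a measurable feature map, and `ν` a σ-finite measure
on the feature space.  Suppose the pushforward `f_* P₀` has density `p₀z` w.r.t. `ν`,
with `p₀z > 0` ν-a.e., and let `pᵢ` be a probability density w.r.t. `ν` vanishing
ν-a.e. where `p₀z` vanishes.  Then the measure `Q` with `dQ/dP₀ (x) = pᵢ(f x)/p₀z(f x)`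
is a probability measure, and the pushforward of `Q` under `f` has density exactly `pᵢ`
w.r.t. `ν`. -/
theorem pdf_projection_theorem
    {Ω Z : Type*} [MeasurableSpace Ω] [MeasurableSpace Z]
    (P₀ : Measure Ω) [IsProbabilityMeasure P₀] (ν : Measure Z) [SigmaFinite ν]
    (f : Ω → Z) (hf : Measurable f)
    (p₀z pᵢ : Z → ℝ) (hp₀zm : Measurable p₀z) (hpᵢm : Measurable pᵢ)
    (hp₀z0 : ∀ z, 0 ≤ p₀z z)
    (hmap : P₀.map f = ν.withDensity (fun z => ENNReal.ofReal (p₀z z)))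
    (hp₀zpos : ∀ᵐ z ∂ν, 0 < p₀z z)
    (hpᵢ0 : ∀ z, 0 ≤ pᵢ z) (hpᵢ1 : ∫ z, pᵢ z ∂ν = 1)
    (hvanish : ∀ᵐ z ∂ν, p₀z z = 0 → pᵢ z = 0) :
    IsProbabilityMeasure
        (P₀.withDensity (fun x => ENNReal.ofReal (pᵢ (f x) / p₀z (f x)))) ∧
      (P₀.withDensity (fun x => ENNReal.ofReal (pᵢ (f x) / p₀z (f x)))).map f =
        ν.withDensity (fun z => ENNReal.ofReal (pᵢ z)) := by
  have hQ : (P₀.withDensity (fun x => ENNReal.ofReal (pᵢ (f x) / p₀z (f x)))).map f =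
      ν.withDensity (fun z => ENNReal.ofReal (pᵢ z)) := by
    have hg : Measurable fun z => ENNReal.ofReal (pᵢ z / p₀z z) :=
      (hpᵢm.div hp₀zm).ennreal_ofReal
    rw [P₀.map_withDensity_comp hf hg, hmap, ← withDensity_mul ν hp₀zm.ennreal_ofReal hg]
    refine withDensity_congr_ae ?_
    filter_upwards [hp₀zpos] with z hz
    rw [Pi.mul_apply, ← ENNReal.ofReal_mul hz.le, mul_div_cancel₀ _ hz.ne']
  have hint : Integrable pᵢ ν := .of_integral_ne_zero (by simp [hpᵢ1])
  refine ⟨⟨?_⟩, hQ⟩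
  rw [← Set.preimage_univ (f := f), ← Measure.map_apply hf .univ, hQ,
    withDensity_apply _ .univ, Measure.restrict_univ,
    ← ofReal_integral_eq_lintegral_ofReal hint (.of_forall hpᵢ0), hpᵢ1, ENNReal.ofReal_one]
end
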